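/- arXiv:2509.17090 — 2 statements merged into one kernel-verified Lean document; each statement's English description precedes it below -/
import Mathlib

section
/- Let A and B be associative Φ-algebras and let φ : A → B be a Jordan homomorphism. If x, y ∈ A satisfy xy = 0 and yx = 0, then φ(x)φ(y) + φ(y)φ(x) = 0, and moreover φ(x)φ(y) commutes with φ(a) for every a ∈ A (hence φ(x)φ(y) commutes with every element of the subalgebra of B generated by the image of φ). -/
/-- If `φ` is a Jordan homomorphism and `xy = yx = 0`, then `φ(x)φ(y) + φ(y)φ(x) = 0`
and `φ(x)φ(y)` commutes with every `φ(a)`, hence with every element of the subalgebra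
of `B` generated by the image of `φ`. -/
theorem jordan_hom_of_orthogonal_commutes
    (Φ : Type*) [CommRing Φ] (A : Type*) [Ring A] [Algebra Φ A]
    (B : Type*) [Ring B] [Algebra Φ B]
    (φ : A →ₗ[Φ] B)
    (hsq : ∀ x, φ (x * x) = φ x * φ x)
    (htr : ∀ x y, φ (x * y * x) = φ x * φ y * φ x)
    (x y : A) (hxy : x * y = 0) (hyx : y * x = 0) :
    φ x * φ y + φ y * φ x = 0 ∧
    (∀ a : A, Commute (φ x * φ y) (φ a)) ∧
    (∀ b ∈ Algebra.adjoin Φ (Set.range φ), Commute (φ x * φ y) b) := by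
  have hmul (u v : A) : φ (u * v + v * u) = φ u * φ v + φ v * φ u := by
    have h := hsq (u + v)
    simp only [mul_add, add_mul, map_add, hsq] at h
    rw [← sub_eq_zero] at h
    rw [map_add, ← sub_eq_zero]
    rw [← h]
    abel
  have htriple (u v w : A) :
      φ (u * v * w + w * v * u) = φ u * φ v * φ w + φ w * φ v * φ u := by
    have h := htr (u + w) v
    simp only [mul_add, add_mul, map_add, htr] at h
    rw [← sub_eq_zero] at h
    rw [map_add, ← sub_eq_zero]
    rw [← h]
    abel
  have hanti : φ x * φ y + φ y * φ x = 0 := by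
    rw [← hmul, hxy, hyx, add_zero, map_zero]
  have hcomm (a : A) : Commute (φ x * φ y) (φ a) := by
    have key : (x * a + a * x) * y + y * (x * a + a * x) = x * a * y + y * a * x := by
      rw [add_mul, mul_add, mul_assoc a x y, hxy, ← mul_assoc y x a, hyx, ← mul_assoc y a x]
      simp
    have h := hmul (x * a + a * x) y
    rw [key, htriple, hmul] at h
    have hsum : φ a * (φ x * φ y) + φ y * φ x * φ a = 0 := by
      rw [← sub_eq_zero.mpr h.symm]
      noncomm_ring
    rw [eq_neg_of_add_eq_zero_right hanti, neg_mul, ← sub_eq_add_neg] at hsum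
    exact (sub_eq_zero.mp hsum).symm
  refine ⟨hanti, hcomm, fun b hb => ?_⟩
  induction hb using Algebra.adjoin_induction with
  | mem b hb =>
    obtain ⟨a, rfl⟩ := hb
    exact hcomm a
  | algebraMap r => exact (Algebra.commutes r _).symm
  | add b c _ _ hb hc => exact hb.add_right hc
  | mul b c _ _ hb hc => exact hb.mul_right hc
end

section
/- Let A be an associative unital Φ-algebra. There exists a Φ-linear bijection σ : U(A) → U(A) satisfying σ(xy) = σ(y)σ(x) for all x, y ∈ U(A), σ ∘ σ = id, and σ(u(a)) = u(a) for all a ∈ A; that is, U(A) carries an involution fixing all elements of u(A). -/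
set_option synthInstance.maxHeartbeats 1000000
set_option maxHeartbeats 1000000

open Matrix MulOpposite

/-- Relations defining the universal special enveloping algebra. -/
inductive URel (Φ : Type*) [CommRing Φ] (A : Type*) [Ring A] [Algebra Φ A] :
    TensorAlgebra Φ A → TensorAlgebra Φ A → Prop
  | sq (a : A) :
      URel Φ A (TensorAlgebra.ι Φ a * TensorAlgebra.ι Φ a) (TensorAlgebra.ι Φ (a * a))
  | tri (a b : A) :
      URel Φ A (TensorAlgebra.ι Φ a * TensorAlgebra.ι Φ b * TensorAlgebra.ι Φ a)
        (TensorAlgebra.ι Φ (a * b * a))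

/-- The universal special enveloping algebra `U(A)`: the quotient of the tensor algebra
of the `Φ`-module `A` by the two-sided ideal generated by all `a⊗a - a²` and
`a⊗b⊗a - aba`. -/
abbrev UA (Φ : Type*) [CommRing Φ] (A : Type*) [Ring A] [Algebra Φ A] :=
  RingQuot (URel Φ A)

/-- The canonical Jordan homomorphism `u : A → U(A)`. -/
noncomputable def uMap (Φ : Type*) [CommRing Φ] (A : Type*) [Ring A] [Algebra Φ A] :
    A →ₗ[Φ] UA Φ A :=
  (RingQuot.mkAlgHom Φ (URel Φ A)).toLinearMap.comp (TensorAlgebra.ι Φ)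

theorem uMap_mul_self (Φ : Type*) [CommRing Φ] (A : Type*) [Ring A] [Algebra Φ A] (a : A) :
    uMap Φ A a * uMap Φ A a = uMap Φ A (a * a) := by
  simpa [uMap] using RingQuot.mkAlgHom_rel Φ (URel.sq (Φ := Φ) a)

theorem uMap_mul_mul_self (Φ : Type*) [CommRing Φ] (A : Type*) [Ring A] [Algebra Φ A] (a b : A) :
    uMap Φ A a * uMap Φ A b * uMap Φ A a = uMap Φ A (a * b * a) := by
  simpa [uMap] using RingQuot.mkAlgHom_rel Φ (URel.tri (Φ := Φ) a b)

/-- The reversal of `U(A)`, as an algebra homomorphism into the opposite algebra. -/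
noncomputable def uaReverse (Φ : Type*) [CommRing Φ] (A : Type*) [Ring A] [Algebra Φ A] :
    UA Φ A →ₐ[Φ] (UA Φ A)ᵐᵒᵖ :=
  RingQuot.liftAlgHom Φ
    ⟨TensorAlgebra.lift Φ ((opLinearEquiv Φ).toLinearMap ∘ₗ uMap Φ A), by
      rintro _ _ (a | ⟨a, b⟩)
      · simp [← op_mul, uMap_mul_self]
      · simp [← op_mul, ← mul_assoc, uMap_mul_mul_self]⟩

theorem uaReverse_uMap (Φ : Type*) [CommRing Φ] (A : Type*) [Ring A] [Algebra Φ A] (a : A) :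
    uaReverse Φ A (uMap Φ A a) = op (uMap Φ A a) := by
  simp [uaReverse, uMap]

theorem unop_uaReverse_unop_uaReverse (Φ : Type*) [CommRing Φ] (A : Type*) [Ring A] [Algebra Φ A]
    (x : UA Φ A) : unop (uaReverse Φ A (unop (uaReverse Φ A x))) = x := by
  have h : (AlgHom.opComm (uaReverse Φ A)).comp (uaReverse Φ A) = AlgHom.id Φ (UA Φ A) := by
    apply RingQuot.ringQuot_ext'
    apply TensorAlgebra.hom_ext
    ext a
    change unop (uaReverse Φ A (unop (uaReverse Φ A (uMap Φ A a)))) = uMap Φ A a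
    simp [uaReverse_uMap]
  exact DFunLike.congr_fun h x

/-- `U(A)` carries an involution: a `Φ`-linear bijection `σ` with `σ(xy) = σ(y)σ(x)`,
`σ ∘ σ = id`, fixing every element of `u(A)`. -/
theorem U_has_involution
    (Φ : Type*) [CommRing Φ] (A : Type*) [Ring A] [Algebra Φ A] :
    ∃ σ : UA Φ A →ₗ[Φ] UA Φ A,
      Function.Bijective σ ∧
      (∀ x y : UA Φ A, σ (x * y) = σ y * σ x) ∧
      (∀ x : UA Φ A, σ (σ x) = x) ∧
      (∀ a : A, σ (uMap Φ A a) = uMap Φ A a) := by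
  refine ⟨(opLinearEquiv Φ).symm.toLinearMap ∘ₗ (uaReverse Φ A).toLinearMap, ?_, ?_, ?_, ?_⟩
  · exact Function.Involutive.bijective (unop_uaReverse_unop_uaReverse Φ A)
  · intro x y
    simp
  · exact unop_uaReverse_unop_uaReverse Φ A
  · intro a
    simp [uaReverse_uMap]
end
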